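/- arXiv:2212.09843 — 15 statements merged into one kernel-verified Lean document; each statement's English description precedes it below -/
import Mathlib

section
/- Let n ≥ 1, let φ : ℝⁿ → ℝ ∪ {+∞} be a proper convex function that is bounded from below, and let ω : ℝⁿ → ℝ be a convex function. Let I = {α ∈ ℝ : Lev_ω(α) ≠ ∅}, and for α ∈ I define h(α) = inf_{x ∈ ℝⁿ} { φ(x) + dist(x, Lev_ω(α))² }, where dist denotes Euclidean distance. Then h is a convex function on the interval I (i.e., for α₁, α₂ ∈ I and λ ∈ [0,1], h(λα₁ + (1−λ)α₂) ≤ λ h(α₁) + (1−λ) h(α₂)). -/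
/-- Lemma 3.1(i): the value function
`h(α) = inf_{x} { φ(x) + dist(x, Lev_ω(α))² }` of a proper convex function `φ`
(bounded below, with effective domain `S`) is convex on the set
`I = {α : Lev_ω(α) ≠ ∅}`. -/
theorem h_convex_on_levelset_interval (n : ℕ) (hn : 1 ≤ n)
    (φ ω : EuclideanSpace ℝ (Fin n) → ℝ)
    (S : Set (EuclideanSpace ℝ (Fin n)))
    (hS : S.Nonempty)
    (hφconv : ConvexOn ℝ S φ)
    (hφbdd : BddBelow (φ '' S))
    (hωconv : ConvexOn ℝ Set.univ ω)
    (h : ℝ → ℝ)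
    (hh : ∀ α : ℝ,
      h α = sInf ((fun x => φ x + (Metric.infDist x {y | ω y ≤ α}) ^ 2) '' S)) :
    ∀ α₁ ∈ {α : ℝ | {x | ω x ≤ α}.Nonempty},
    ∀ α₂ ∈ {α : ℝ | {x | ω x ≤ α}.Nonempty},
    ∀ l : ℝ, 0 ≤ l → l ≤ 1 →
      h (l * α₁ + (1 - l) * α₂) ≤ l * h α₁ + (1 - l) * h α₂ := by
  intro α₁ h₁ α₂ h₂ l hl hl1
  have hm : 0 ≤ 1 - l := by linarith
  have key : ∀ x₁ x₂ : EuclideanSpace ℝ (Fin n),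
      Metric.infDist (l • x₁ + (1 - l) • x₂) {y | ω y ≤ l * α₁ + (1 - l) * α₂} ≤
        l * Metric.infDist x₁ {y | ω y ≤ α₁} + (1 - l) * Metric.infDist x₂ {y | ω y ≤ α₂} := by
    intro x₁ x₂
    refine le_of_forall_pos_le_add fun ε hε => ?_
    obtain ⟨y₁, hy₁, hd₁⟩ := (Metric.infDist_lt_iff (x := x₁) h₁).1 (lt_add_of_pos_right _ hε)
    obtain ⟨y₂, hy₂, hd₂⟩ := (Metric.infDist_lt_iff (x := x₂) h₂).1 (lt_add_of_pos_right _ hε)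
    have hy : ω (l • y₁ + (1 - l) • y₂) ≤ l * α₁ + (1 - l) * α₂ := by
      have h3 := hωconv.2 (Set.mem_univ y₁) (Set.mem_univ y₂) hl hm (by ring)
      simp only [smul_eq_mul] at h3
      have h4 := mul_le_mul_of_nonneg_left (show ω y₁ ≤ α₁ from hy₁) hl
      have h5 := mul_le_mul_of_nonneg_left (show ω y₂ ≤ α₂ from hy₂) hm
      linarith
    have h6 := Metric.infDist_le_dist_of_mem (x := l • x₁ + (1 - l) • x₂)
      (s := {y | ω y ≤ l * α₁ + (1 - l) * α₂}) hy
    have h7 := dist_add_add_le (l • x₁) ((1 - l) • x₂) (l • y₁) ((1 - l) • y₂)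
    rw [dist_smul₀, dist_smul₀, Real.norm_of_nonneg hl, Real.norm_of_nonneg hm] at h7
    have h8 := mul_le_mul_of_nonneg_left hd₁.le hl
    have h9 := mul_le_mul_of_nonneg_left hd₂.le hm
    linarith
  obtain ⟨b, hb⟩ := hφbdd
  refine le_of_forall_pos_le_add fun ε hε => ?_
  have ex : ∀ α : ℝ, ∃ x ∈ S, φ x + (Metric.infDist x {y | ω y ≤ α}) ^ 2 < h α + ε := by
    intro α
    obtain ⟨_, ⟨x, hx, rfl⟩, hlt⟩ := exists_lt_of_csInf_lt (hS.image _)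
      (show sInf ((fun x => φ x + (Metric.infDist x {y | ω y ≤ α}) ^ 2) '' S) < h α + ε by
        rw [← hh]; linarith)
    exact ⟨x, hx, hlt⟩
  obtain ⟨x₁, hx₁, hv₁⟩ := ex α₁
  obtain ⟨x₂, hx₂, hv₂⟩ := ex α₂
  have hle : h (l * α₁ + (1 - l) * α₂) ≤ φ (l • x₁ + (1 - l) • x₂) +
      (Metric.infDist (l • x₁ + (1 - l) • x₂) {y | ω y ≤ l * α₁ + (1 - l) * α₂}) ^ 2 := by
    rw [hh]
    refine csInf_le ⟨b, ?_⟩ ⟨_, hφconv.1 hx₁ hx₂ hl hm (by ring), rfl⟩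
    rintro _ ⟨x, hx, rfl⟩
    have := hb ⟨x, hx, rfl⟩
    have := sq_nonneg (Metric.infDist x {y | ω y ≤ l * α₁ + (1 - l) * α₂})
    dsimp only
    linarith
  have hφ := hφconv.2 hx₁ hx₂ hl hm (by ring)
  simp only [smul_eq_mul] at hφ
  have hsq := pow_le_pow_left₀ Metric.infDist_nonneg (key x₁ x₂) 2
  generalize Metric.infDist x₁ {y | ω y ≤ α₁} = d₁ at *
  generalize Metric.infDist x₂ {y | ω y ≤ α₂} = d₂ at *
  have hc : (l * d₁ + (1 - l) * d₂) ^ 2 ≤ l * d₁ ^ 2 + (1 - l) * d₂ ^ 2 := by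
    have := mul_nonneg (mul_nonneg hl hm) (sq_nonneg (d₁ - d₂))
    linarith
  have h8 := mul_le_mul_of_nonneg_left hv₁.le hl
  have h9 := mul_le_mul_of_nonneg_left hv₂.le hm
  linarith
end

section
/- Let n ≥ 1, let φ : ℝⁿ → ℝ ∪ {+∞} be a proper convex function bounded from below whose set of minimizers X* = argmin φ is nonempty, with optimal value φ* = min φ, and let ω : ℝⁿ → ℝ be convex such that ω attains its minimum over X*; set ω* = min_{x ∈ X*} ω(x) and let ω̲ = inf_{x ∈ ℝⁿ} ω(x). For α with Lev_ω(α) ≠ ∅ define h(α) = inf_{x ∈ ℝⁿ} { φ(x) + dist(x, Lev_ω(α))² }, and assume that for every such α this infimum is attained. Then: (a) h is nonincreasing on {α : Lev_ω(α) ≠ ∅}; (b) h(α) = φ* for every α ≥ ω*, and h(α) > φ* for every α < ω* with Lev_ω(α) ≠ ∅; (c) h is strictly decreasing on the interval (ω̲, ω*), i.e., ω̲ < α₁ < α₂ < ω* implies h(α₁) > h(α₂). -/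
/-- Lemma 3.1(ii): monotonicity properties of the value function
`h(α) = inf_x { φ(x) + dist(x, Lev_ω(α))² }`.  Here `φ` is a proper convex function
bounded below (effective domain `S`), `x0` is a minimizer of `φ` over `S`
(so `φ* = φ x0`, `X* = {x ∈ S | φ x = φ x0}`), and `xw ∈ X*` minimizes `ω` over `X*`
(so `ω* = ω xw`).  (a) `h` is nonincreasing on `{α : Lev_ω(α) ≠ ∅}`;
(b) `h(α) = φ*` for `α ≥ ω*` and `h(α) > φ*` for `α < ω*` with nonempty level set;
(c) `h` is strictly decreasing on `(inf ω, ω*)`, where `inf ω < α₁` is expressed as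
`∃ x, ω x < α₁`. -/
theorem h_monotonicity (n : ℕ) (hn : 1 ≤ n)
    (φ ω : EuclideanSpace ℝ (Fin n) → ℝ)
    (S : Set (EuclideanSpace ℝ (Fin n)))
    (hS : S.Nonempty)
    (hφconv : ConvexOn ℝ S φ)
    (hφbdd : BddBelow (φ '' S))
    (hωconv : ConvexOn ℝ Set.univ ω)
    (x0 : EuclideanSpace ℝ (Fin n)) (hx0S : x0 ∈ S)
    (hx0min : ∀ y ∈ S, φ x0 ≤ φ y)
    (xw : EuclideanSpace ℝ (Fin n)) (hxwS : xw ∈ S) (hxwopt : φ xw = φ x0)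
    (hxwmin : ∀ y ∈ S, φ y = φ x0 → ω xw ≤ ω y)
    (h : ℝ → ℝ)
    (hh : ∀ α : ℝ,
      h α = sInf ((fun x => φ x + (Metric.infDist x {y | ω y ≤ α}) ^ 2) '' S))
    (hattain : ∀ α : ℝ, {y | ω y ≤ α}.Nonempty →
      ∃ x ∈ S, h α = φ x + (Metric.infDist x {y | ω y ≤ α}) ^ 2) :
    (∀ α₁ α₂ : ℝ, {y | ω y ≤ α₁}.Nonempty → {y | ω y ≤ α₂}.Nonempty →
      α₁ ≤ α₂ → h α₂ ≤ h α₁) ∧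
    (∀ α : ℝ, ω xw ≤ α → h α = φ x0) ∧
    (∀ α : ℝ, α < ω xw → {y | ω y ≤ α}.Nonempty → φ x0 < h α) ∧
    (∀ α₁ α₂ : ℝ, (∃ x, ω x < α₁) → α₁ < α₂ → α₂ < ω xw → h α₂ < h α₁) := by
  have hcont : Continuous ω := by
    rw [← continuousOn_univ]
    exact hωconv.continuousOn isOpen_univ
  have hcl : ∀ α : ℝ, IsClosed {y | ω y ≤ α} := fun α => isClosed_le hcont continuous_const
  have hle : ∀ α : ℝ, ∀ x ∈ S, h α ≤ φ x + (Metric.infDist x {y | ω y ≤ α}) ^ 2 := by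
    intro α x hx
    rw [hh α]
    refine csInf_le ⟨φ x0, ?_⟩ ⟨x, hx, rfl⟩
    rintro _ ⟨y, hy, rfl⟩
    have := hx0min y hy
    have := sq_nonneg (Metric.infDist y {y | ω y ≤ α})
    simp only
    linarith
  have hb2 : ∀ α : ℝ, α < ω xw → {y | ω y ≤ α}.Nonempty → φ x0 < h α := by
    intro α hα hne
    obtain ⟨x, hx, hxe⟩ := hattain α hne
    have h1 := hx0min x hx
    have h2 := sq_nonneg (Metric.infDist x {y | ω y ≤ α})
    by_contra hcon
    have h3 : φ x = φ x0 := by linarith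
    have h4 : (Metric.infDist x {y | ω y ≤ α}) ^ 2 = 0 := by linarith
    have h5 : Metric.infDist x {y | ω y ≤ α} = 0 := by simpa using h4
    have h6 : x ∈ {y | ω y ≤ α} := ((hcl α).mem_iff_infDist_zero hne).2 h5
    have h7 : ω x ≤ α := h6
    have := hxwmin x hx h3
    linarith
  refine ⟨?_, ?_, hb2, ?_⟩
  · intro α₁ α₂ h1 h2 h12
    obtain ⟨x, hx, hxe⟩ := hattain α₁ h1
    have h3 : Metric.infDist x {y | ω y ≤ α₂} ≤ Metric.infDist x {y | ω y ≤ α₁} :=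
      Metric.infDist_le_infDist_of_subset (fun y (hy : ω y ≤ α₁) => le_trans hy h12) h1
    have h4 := hle α₂ x hx
    have h5 := pow_le_pow_left₀ Metric.infDist_nonneg h3 2
    linarith
  · intro α hα
    have hm : xw ∈ {y | ω y ≤ α} := hα
    apply le_antisymm
    · have := hle α xw hxwS
      rw [Metric.infDist_zero_of_mem hm] at this
      linarith
    · obtain ⟨x, hx, hxe⟩ := hattain α ⟨xw, hm⟩
      have h1 := hx0min x hx
      have h2 := sq_nonneg (Metric.infDist x {y | ω y ≤ α})
      linarith
  · rintro α₁ α₂ ⟨z, hz⟩ h12 h2w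
    have hne : {y | ω y ≤ α₁}.Nonempty := ⟨z, hz.le⟩
    have hlt := hb2 α₁ (h12.trans h2w) hne
    obtain ⟨x, hx, hxe⟩ := hattain α₁ hne
    obtain ⟨p, hp, hpd⟩ := (hcl α₁).exists_infDist_eq_dist hne x
    have hp' : ω p ≤ α₁ := hp
    obtain ⟨t, ht0, ht1, ht⟩ : ∃ t : ℝ, 0 < t ∧ t < 1 ∧ (1 - t) * α₁ + t * ω xw = α₂ := by
      have hd : 0 < ω xw - α₁ := by linarith
      refine ⟨(α₂ - α₁) / (ω xw - α₁), div_pos (by linarith) hd, ?_, ?_⟩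
      · rw [div_lt_one hd]; linarith
      · field_simp
        ring
    have hs : 0 ≤ 1 - t := by linarith
    have hxt := hφconv.1 hx hxwS hs ht0.le (by ring)
    have hφt := hφconv.2 hx hxwS hs ht0.le (by ring)
    have hωt := hωconv.2 (Set.mem_univ p) (Set.mem_univ xw) hs ht0.le (by ring)
    simp only [smul_eq_mul] at hφt hωt
    have hpt : (1 - t) • p + t • xw ∈ {y | ω y ≤ α₂} := by
      show ω _ ≤ α₂
      have := mul_le_mul_of_nonneg_left hp' hs
      linarith
    have hdist : Metric.infDist ((1 - t) • x + t • xw) {y | ω y ≤ α₂} ≤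
        (1 - t) * Metric.infDist x {y | ω y ≤ α₁} := by
      refine (Metric.infDist_le_dist_of_mem hpt).trans ?_
      rw [hpd, dist_add_right, dist_smul₀, Real.norm_of_nonneg hs]
    have h5 := pow_le_pow_left₀ Metric.infDist_nonneg hdist 2
    have h6 := hle α₂ _ hxt
    have h7 := sq_nonneg (Metric.infDist x {y | ω y ≤ α₁})
    rw [mul_pow] at h5
    rw [hxwopt] at hφt
    have h8 : (1 - t) ^ 2 ≤ 1 - t := by nlinarith
    have h9 := mul_le_mul_of_nonneg_right h8 h7
    have h10 : h α₂ ≤ (1 - t) * h α₁ + t * φ x0 := by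
      rw [hxe, mul_add]; linarith
    have h11 := mul_lt_mul_of_pos_left hlt ht0
    linarith
end

section
/- Let n ≥ 1, σ > 0, and let ω : ℝⁿ → ℝ be σ-strongly convex, i.e., x ↦ ω(x) − (σ/2)‖x‖² is convex. Then ω has a 2-power global error bound with constant γ = 2/σ: for every α ≥ inf_{x ∈ ℝⁿ} ω(x) and every x ∈ ℝⁿ, dist(x, Lev_ω(α))² ≤ (2/σ) · max(ω(x) − α, 0). -/
/-- Proposition 2.5: a `σ`-strongly convex function `ω` has a
2-power global error bound with constant `γ = 2/σ`:
`dist(x, Lev_ω(α))² ≤ (2/σ)·[ω(x) − α]₊` for every `α ≥ inf ω` and every `x`. -/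
theorem strongly_convex_error_bound (n : ℕ) (hn : 1 ≤ n) (σ : ℝ) (hσ : 0 < σ)
    (ω : EuclideanSpace ℝ (Fin n) → ℝ)
    (hω : ConvexOn ℝ Set.univ (fun x => ω x - σ / 2 * ‖x‖ ^ 2)) :
    ∀ α : ℝ, (⨅ x, ω x) ≤ α → ∀ x : EuclideanSpace ℝ (Fin n),
      Metric.infDist x {y | ω y ≤ α} ^ 2 ≤ 2 / σ * max (ω x - α) 0 := by
  intro α _ x
  have hs := (strongConvexOn_iff_convex.2 hω).2
  have hnn : 0 ≤ 2 / σ * max (ω x - α) 0 := by positivity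
  rcases Set.eq_empty_or_nonempty {y | ω y ≤ α} with he | hne
  · rw [he, Metric.infDist_empty]
    simpa using hnn
  set d := Metric.infDist x {y | ω y ≤ α} with hd
  have hd0 : 0 ≤ d := Metric.infDist_nonneg
  rcases hd0.eq_or_lt with h0 | hpos
  · rw [← h0]
    simpa using hnn
  have key : ∀ t : ℝ, 0 < t → t < 1 → (1 - t) * (σ / 2 * d ^ 2) ≤ ω x - α := by
    intro t ht ht1
    have h1 : 0 < 1 - t := by linarith
    have hlt : d < d / (1 - t) := by
      rw [lt_div_iff₀ h1]; nlinarith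
    obtain ⟨p, hp, hxp⟩ := (Metric.infDist_lt_iff hne).1 hlt
    have hp' : ω p ≤ α := hp
    have hdp : d ≤ dist x p := Metric.infDist_le_dist_of_mem hp
    rw [lt_div_iff₀ h1] at hxp
    have hz : α < ω (t • x + (1 - t) • p) := by
      by_contra hcon
      have hz' := Metric.infDist_le_dist_of_mem (x := x)
        (show t • x + (1 - t) • p ∈ {y | ω y ≤ α} from not_lt.1 hcon)
      have : dist x (t • x + (1 - t) • p) = dist x p * (1 - t) := by
        rw [dist_eq_norm, dist_eq_norm,
          show x - (t • x + (1 - t) • p) = (1 - t) • (x - p) by module,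
          norm_smul, Real.norm_of_nonneg h1.le, mul_comm]
      rw [this] at hz'
      linarith
    have hc := hs (Set.mem_univ x) (Set.mem_univ p) ht.le h1.le (by ring)
    simp only [smul_eq_mul] at hc
    rw [← dist_eq_norm] at hc
    have hsq : d ^ 2 ≤ dist x p ^ 2 := by gcongr
    have h2 : t * ((1 - t) * (σ / 2 * d ^ 2)) ≤ t * ((1 - t) * (σ / 2 * dist x p ^ 2)) := by
      gcongr
    have h3 : (1 - t) * ω p ≤ (1 - t) * α := by gcongr
    refine le_of_mul_le_mul_left ?_ ht
    linarith
  have hB : 0 < σ / 2 * d ^ 2 := by positivity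
  have fin : σ / 2 * d ^ 2 ≤ ω x - α := by
    have hlim : Filter.Tendsto (fun t : ℝ => (1 - t) * (σ / 2 * d ^ 2)) (nhdsWithin 0 (Set.Ioi 0))
        (nhds ((1 - 0) * (σ / 2 * d ^ 2))) :=
      (Continuous.tendsto (by fun_prop) 0).mono_left nhdsWithin_le_nhds
    have := le_of_tendsto hlim (by
      filter_upwards [Ioo_mem_nhdsGT (show (0 : ℝ) < 1 by norm_num)] with t ht
      exact key t ht.1 ht.2)
    linarith
  calc d ^ 2 = 2 / σ * (σ / 2 * d ^ 2) := by field_simp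
    _ ≤ 2 / σ * max (ω x - α) 0 := by
      gcongr
      exact fin.trans (le_max_left _ _)
end

section
/- Let n ≥ 1 and let ω : ℝⁿ → ℝ be a convex function bounded from below, with ω̲ = inf_{x ∈ ℝⁿ} ω(x). Suppose there exists τ > 0 such that for every x ∈ ℝⁿ with ω(x) > ω̲ and every subgradient v of ω at x (i.e., v satisfying ω(y) ≥ ω(x) + ⟨v, y − x⟩ for all y), one has ‖v‖ ≥ τ. Then for every α ≥ ω̲ such that Lev_ω(α) ≠ ∅ and every x ∈ ℝⁿ, dist(x, Lev_ω(α)) ≤ τ⁻¹ · max(ω(x) − α, 0). -/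
open RealInnerProductSpace in
lemma exists_small_subgradient {n : ℕ} (ω : EuclideanSpace ℝ (Fin n) → ℝ)
    (hc : ConvexOn ℝ Set.univ ω) (hcont : Continuous ω) (σ : ℝ) (hσ : 0 < σ)
    (z : EuclideanSpace ℝ (Fin n)) (hz : ∀ y, ω z - σ * dist y z ≤ ω y) :
    ∃ v : EuclideanSpace ℝ (Fin n), ‖v‖ ≤ σ ∧ ∀ y, ω z + ⟪v, y - z⟫ ≤ ω y := by
  have hconc : ConcaveOn ℝ Set.univ (fun y => ω z - σ * dist y z) := by
    have h1 := ((convexOn_univ_dist z).smul hσ.le).neg.add_const (ω z)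
    refine h1.congr ?_
    intro y _
    simp [smul_eq_mul]
    ring
  obtain ⟨f, u, h1, h2⟩ := geometric_hahn_banach_open (E := EuclideanSpace ℝ (Fin n) × ℝ)
    hc.convex_strict_epigraph
    (by simpa using isOpen_lt (hcont.comp continuous_fst) continuous_snd)
    hconc.convex_hypograph
    (by
      rw [Set.disjoint_left]
      rintro ⟨y, t⟩ ⟨_, ha⟩ ⟨_, hb⟩
      have := hz y
      simp only at ha hb
      linarith)
  set c : ℝ := f (0, 1) with hcdef
  set g : StrongDual ℝ (EuclideanSpace ℝ (Fin n)) :=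
    f.comp (ContinuousLinearMap.inl ℝ (EuclideanSpace ℝ (Fin n)) ℝ) with hg
  have hf : ∀ y t, f (y, t) = g y + t * c := by
    intro y t
    have : ((y, t) : EuclideanSpace ℝ (Fin n) × ℝ) = (y, 0) + t • (0, 1) := by simp
    rw [this, map_add, map_smul]
    simp [hg, hcdef]
  have h1' : ∀ y t, ω y < t → g y + t * c < u := fun y t h => by
    rw [← hf]; exact h1 _ ⟨trivial, h⟩
  have h2' : ∀ y, u ≤ g y + (ω z - σ * dist y z) * c := fun y => by
    rw [← hf]; exact h2 _ ⟨trivial, le_rfl⟩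
  have h1'' : ∀ y, g y + ω y * c ≤ u := by
    intro y
    have ht : Filter.Tendsto (fun t : ℝ => g y + t * c) (nhdsWithin (ω y) (Set.Ioi (ω y)))
        (nhds (g y + ω y * c)) := by
      apply Filter.Tendsto.mono_left _ nhdsWithin_le_nhds
      exact Continuous.tendsto (by fun_prop) _
    refine le_of_tendsto ht ?_
    filter_upwards [self_mem_nhdsWithin] with t ht
    exact (h1' y t ht).le
  have hu := h2' z
  rw [dist_self, mul_zero, sub_zero] at hu
  have hcneg : c < 0 := by
    have := h1' z (ω z + 1) (by linarith)
    linarith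
  have hb : 0 < -c := by linarith
  let v := (InnerProductSpace.toDual ℝ (EuclideanSpace ℝ (Fin n))).symm ((-c)⁻¹ • g)
  have hv : ∀ w, ⟪v, w⟫ = (-c)⁻¹ * g w := by
    intro w
    simp only [v, InnerProductSpace.toDual_symm_apply]
    simp
  refine ⟨v, ?_, ?_⟩
  · have h := h2' (z - v)
    have h3 := h1'' z
    have h4 := hv v
    rw [real_inner_self_eq_norm_sq] at h4
    rw [map_sub, dist_eq_norm, sub_sub_cancel_left, norm_neg] at h
    have h5 : g v = (-c) * ‖v‖ ^ 2 := by rw [h4, mul_inv_cancel_left₀ hb.ne']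
    rw [h5] at h
    have h6 : (-c) * ‖v‖ ^ 2 ≤ (-c) * (σ * ‖v‖) := by linarith
    have h7 := le_of_mul_le_mul_left h6 hb
    by_contra hlt
    push Not at hlt
    nlinarith [norm_nonneg v]
  · intro y
    rw [hv, map_sub]
    have h3 := h1'' y
    have : (-c)⁻¹ * (g y - g z) ≤ ω y - ω z := by
      rw [inv_mul_le_iff₀ hb]
      linarith
    linarith

open RealInnerProductSpace in
/-- Proposition 2.6: if every subgradient of the convex function
`ω` at every non-minimizing point has norm at least `τ > 0`, then `ω` has a
1-power global error bound with constant `τ⁻¹`. -/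
theorem subgradient_norm_error_bound (n : ℕ) (hn : 1 ≤ n) (τ : ℝ) (hτ : 0 < τ)
    (ω : EuclideanSpace ℝ (Fin n) → ℝ)
    (hωconv : ConvexOn ℝ Set.univ ω)
    (hbdd : BddBelow (Set.range ω))
    (hsub : ∀ x v : EuclideanSpace ℝ (Fin n),
      (⨅ z, ω z) < ω x → (∀ y, ω x + ⟪v, y - x⟫ ≤ ω y) → τ ≤ ‖v‖) :
    ∀ α : ℝ, (⨅ z, ω z) ≤ α → {y | ω y ≤ α}.Nonempty →
      ∀ x : EuclideanSpace ℝ (Fin n),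
        Metric.infDist x {y | ω y ≤ α} ≤ τ⁻¹ * max (ω x - α) 0 := by
  intro α hα hne x
  have hcont : Continuous ω := hωconv.locallyLipschitz.continuous
  by_contra hlt
  push Not at hlt
  set d := Metric.infDist x {y | ω y ≤ α} with hd
  set m := max (ω x - α) 0 with hm
  have hm0 : 0 ≤ m := le_max_right _ _
  have hmd : m < τ * d := by rwa [inv_mul_lt_iff₀ hτ] at hlt
  have hdpos : 0 < d := lt_of_le_of_lt (by positivity) hlt
  obtain ⟨σ, hσ1, hσ2⟩ := exists_between ((div_lt_iff₀ hdpos).2 hmd)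
  have hσ : 0 < σ := lt_of_le_of_lt (by positivity) hσ1
  rw [div_lt_iff₀ hdpos] at hσ1
  have hψx : max (ω x) α = α + m := by
    rw [hm]
    rcases le_total (ω x) α with h | h
    · rw [max_eq_right h, max_eq_right (by linarith)]; ring
    · rw [max_eq_left h, max_eq_left (by linarith)]; ring
  obtain ⟨z, hz⟩ := Continuous.exists_forall_le' (f := fun y => max (ω y) α + σ * dist y x)
    (by fun_prop) x (by
      filter_upwards [(isCompact_closedBall x d).compl_mem_cocompact] with y hy
      simp only [Set.mem_compl_iff, Metric.mem_closedBall, not_le] at hy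
      rw [hψx, dist_self]
      have := le_max_right (ω y) α
      nlinarith)
  have hzα : α < ω z := by
    by_contra h
    push Not at h
    have h1 : d ≤ dist x z := Metric.infDist_le_dist_of_mem h
    have h2 := hz x
    rw [hψx, dist_self, dist_comm z x] at h2
    have := le_max_right (ω z) α
    nlinarith
  have hloc : IsLocalMin (fun y => ω y + σ * dist y x) z := by
    filter_upwards [hcont.continuousAt.eventually (lt_mem_nhds hzα)] with y hy
    have := hz y
    rwa [max_eq_left hy.le, max_eq_left hzα.le] at this
  have hglob := IsMinOn.of_isLocalMin_of_convex_univ hloc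
    (hωconv.add ((convexOn_univ_dist x).smul hσ.le))
  obtain ⟨v, hv1, hv2⟩ := exists_small_subgradient ω hωconv hcont σ hσ z (by
    intro y
    have h1 := hglob y
    have h2 := dist_triangle y z x
    change ω z + σ * dist z x ≤ ω y + σ * dist y x at h1
    nlinarith)
  have := hsub z v (by linarith) hv2
  linarith
end

section
/- Let n ≥ 1. Let φ : ℝⁿ → ℝ ∪ {+∞} be proper with nonempty minimizer set X* = argmin φ and optimal value φ* = min φ. Let ω : ℝⁿ → ℝ be convex, attaining its minimum over X*, with ω* = min_{x ∈ X*} ω(x) and ω̲ = inf_{x ∈ ℝⁿ} ω(x). Assume ω has a κ-power γ-global error bound for some κ ∈ (0,2] and γ > 0. For α with Lev_ω(α) ≠ ∅ let h(α) = inf_{x ∈ ℝⁿ} { φ(x) + dist(x, Lev_ω(α))² }. Then: (i) for every α ∈ [ω̲, ω*] with Lev_ω(α) ≠ ∅, h(α) ≤ φ* + (γ(ω* − α))^{2/κ}; (ii) consequently, for any φ̄ ≥ φ*, any α ∈ [ω̲, ω*] with Lev_ω(α) ≠ ∅, and any ρ with 0 < ρ ≤ h(α) − φ̄, one has α + ρ^{κ/2}/γ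 ≤ ω*. -/
/-- Theorem 3.6, expansion oracle validity: if `ω` has a κ-power
γ-global error bound, `x0` minimizes `φ` over its domain `S` (`φ* = φ x0`), and `xw`
minimizes `ω` over the minimizer set `X* = {x ∈ S | φ x = φ x0}` (`ω* = ω xw`),
then (i) `h(α) ≤ φ* + (γ(ω* − α))^{2/κ}` for every `α ≤ ω*` with nonempty level set,
and (ii) for any `φ̄ ≥ φ*` and `0 < ρ ≤ h(α) − φ̄` one has `α + ρ^{κ/2}/γ ≤ ω*`. -/
theorem expansion_oracle_valid (n : ℕ) (hn : 1 ≤ n)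
    (κ γ : ℝ) (hκ0 : 0 < κ) (hκ2 : κ ≤ 2) (hγ : 0 < γ)
    (φ ω : EuclideanSpace ℝ (Fin n) → ℝ)
    (S : Set (EuclideanSpace ℝ (Fin n)))
    (hS : S.Nonempty)
    (hωconv : ConvexOn ℝ Set.univ ω)
    (x0 : EuclideanSpace ℝ (Fin n)) (hx0S : x0 ∈ S)
    (hx0min : ∀ y ∈ S, φ x0 ≤ φ y)
    (xw : EuclideanSpace ℝ (Fin n)) (hxwS : xw ∈ S) (hxwopt : φ xw = φ x0)
    (hxwmin : ∀ y ∈ S, φ y = φ x0 → ω xw ≤ ω y)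
    (heb : ∀ (x : EuclideanSpace ℝ (Fin n)) (α : ℝ), {y | ω y ≤ α}.Nonempty →
      Metric.infDist x {y | ω y ≤ α} ^ κ ≤ γ * max (ω x - α) 0)
    (h : ℝ → ℝ)
    (hh : ∀ α : ℝ,
      h α = sInf ((fun x => φ x + (Metric.infDist x {y | ω y ≤ α}) ^ 2) '' S)) :
    (∀ α : ℝ, {y | ω y ≤ α}.Nonempty → α ≤ ω xw →
      h α ≤ φ x0 + (γ * (ω xw - α)) ^ ((2 : ℝ) / κ)) ∧
    (∀ φbar : ℝ, φ x0 ≤ φbar → ∀ α : ℝ, {y | ω y ≤ α}.Nonempty → α ≤ ω xw →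
      ∀ ρ : ℝ, 0 < ρ → ρ ≤ h α - φbar → α + ρ ^ (κ / 2) / γ ≤ ω xw) := by
  have key : ∀ α : ℝ, {y | ω y ≤ α}.Nonempty → α ≤ ω xw →
      h α ≤ φ x0 + (γ * (ω xw - α)) ^ ((2 : ℝ) / κ) := by
    intro α hα hle
    have hd : 0 ≤ Metric.infDist xw {y | ω y ≤ α} := Metric.infDist_nonneg
    have h1 : h α ≤ φ xw + (Metric.infDist xw {y | ω y ≤ α}) ^ 2 := by
      rw [hh]
      refine csInf_le ⟨φ x0, ?_⟩ ⟨xw, hxwS, rfl⟩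
      rintro _ ⟨y, hy, rfl⟩
      have := hx0min y hy
      have := sq_nonneg (Metric.infDist y {y | ω y ≤ α})
      simp only
      linarith
    have h2 := heb xw α hα
    rw [max_eq_left (by linarith)] at h2
    have h3 := Real.rpow_le_rpow (by positivity) h2 (show (0 : ℝ) ≤ 2 / κ by positivity)
    rw [← Real.rpow_mul hd, mul_div_cancel₀ _ hκ0.ne', Real.rpow_two] at h3
    linarith
  refine ⟨key, ?_⟩
  intro φbar hφ α hα hle ρ hρ hρh
  have h1 := key α hα hle
  have h2 : ρ ≤ (γ * (ω xw - α)) ^ ((2 : ℝ) / κ) := by linarith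
  have h0 : 0 ≤ γ * (ω xw - α) := mul_nonneg hγ.le (by linarith)
  have h3 := Real.rpow_le_rpow hρ.le h2 (show (0 : ℝ) ≤ κ / 2 by positivity)
  rw [← Real.rpow_mul h0, show (2 : ℝ) / κ * (κ / 2) = 1 by field_simp, Real.rpow_one] at h3
  have h4 : ρ ^ (κ / 2) / γ ≤ ω xw - α := by
    rw [div_le_iff₀ hγ]; linarith
  linarith
end

section
/- Let n ≥ 1 and L > 0. Let f : ℝⁿ → ℝ be convex and differentiable with L-Lipschitz continuous gradient (‖∇f(x) − ∇f(y)‖ ≤ L‖x − y‖ for all x, y). Let x* be a global minimizer of f with f* = f(x*). Let ω : ℝⁿ → ℝ be convex with ω̲ = inf ω, and assume ω has a κ-power γ-global error bound for some κ ∈ (0,2] and γ > 0, with closed nonempty level sets Lev_ω(α) for α ≥ ω̲. Set ω* = ω(x*). Then for every α ∈ [ω̲, ω*], inf_{x ∈ Lev_ω(α)} f(x) ≤ f* + (L/2) · (γ(ω* − α))^{2/κ}. Consequently, writing h(α) = inf_{x ∈ Lev_ω(α)} f(x), for any φ̄ ≥ f* and any ρ with 0 < ρ ≤ h(α) − φ̄,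 one has α + (1/γ)(2ρ/L)^{κ/2} ≤ ω*. -/
theorem descent_aux {E : Type*} [NormedAddCommGroup E] [InnerProductSpace ℝ E] [CompleteSpace E]
    (L : ℝ) (f : E → ℝ) (f' : E → E)
    (hf' : ∀ x, HasGradientAt f (f' x) x)
    (hlip : ∀ x y, ‖f' x - f' y‖ ≤ L * ‖x - y‖)
    (x : E) (hx : ∀ y, f x ≤ f y) (y : E) : f y ≤ f x + L / 2 * ‖y - x‖ ^ 2 := by
  have h0 : f' x = 0 := by
    have h1 : IsLocalMin f x := Filter.Eventually.of_forall hx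
    have h2 := h1.hasFDerivAt_eq_zero (hf' x).hasFDerivAt
    simpa using h2
  have hd : ∀ t : ℝ, HasDerivAt (fun t : ℝ => f (x + t • (y - x)) - L / 2 * ‖y - x‖ ^ 2 * t ^ 2)
      (inner ℝ (f' (x + t • (y - x))) (y - x) - L / 2 * ‖y - x‖ ^ 2 * (2 * t)) t := by
    intro t
    have h1 : HasDerivAt (fun t : ℝ => x + t • (y - x)) (y - x) t := by
      simpa using ((hasDerivAt_id t).smul_const (y - x)).const_add x
    have h2 := (hf' (x + t • (y - x))).hasFDerivAt.comp_hasDerivAt t h1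
    have h3 : HasDerivAt (fun t : ℝ => L / 2 * ‖y - x‖ ^ 2 * t ^ 2)
        (L / 2 * ‖y - x‖ ^ 2 * (2 * t)) t := by
      simpa using (hasDerivAt_pow 2 t).const_mul (L / 2 * ‖y - x‖ ^ 2)
    exact h2.sub h3
  have hanti := antitoneOn_of_deriv_nonpos (convex_Icc (0 : ℝ) 1)
    (fun t _ => (hd t).continuousAt.continuousWithinAt)
    (fun t _ => (hd t).differentiableAt.differentiableWithinAt)
    (by
      intro t ht
      rw [interior_Icc] at ht
      rw [(hd t).deriv]
      have h1 := real_inner_le_norm (f' (x + t • (y - x))) (y - x)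
      have h2 := hlip (x + t • (y - x)) x
      rw [h0, sub_zero, add_sub_cancel_left, norm_smul, Real.norm_of_nonneg ht.1.le] at h2
      have h3 := mul_le_mul_of_nonneg_right h2 (norm_nonneg (y - x))
      linarith)
  have := hanti (Set.left_mem_Icc.2 zero_le_one) (Set.right_mem_Icc.2 zero_le_one) zero_le_one
  simp at this
  linarith

/-- Proposition 5.1, expansion oracle for a smooth inner function:
for convex `f` with `L`-Lipschitz gradient and global minimizer `x*`, and `ω` convex
with a κ-power γ-global error bound and closed nonempty level sets above `inf ω`,
one has `inf_{Lev_ω(α)} f ≤ f* + (L/2)(γ(ω* − α))^{2/κ}` for `α ∈ [inf ω, ω*]`;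
consequently `0 < ρ ≤ h(α) − φ̄` with `φ̄ ≥ f*` implies `α + (1/γ)(2ρ/L)^{κ/2} ≤ ω*`. -/
theorem smooth_expansion_oracle (n : ℕ) (hn : 1 ≤ n) (L : ℝ) (hL : 0 < L)
    (f ω : EuclideanSpace ℝ (Fin n) → ℝ)
    (f' : EuclideanSpace ℝ (Fin n) → EuclideanSpace ℝ (Fin n))
    (hfconv : ConvexOn ℝ Set.univ f)
    (hf' : ∀ x, HasGradientAt f (f' x) x)
    (hlip : ∀ x y, ‖f' x - f' y‖ ≤ L * ‖x - y‖)
    (xstar : EuclideanSpace ℝ (Fin n)) (hxstar : ∀ y, f xstar ≤ f y)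
    (κ γ : ℝ) (hκ0 : 0 < κ) (hκ2 : κ ≤ 2) (hγ : 0 < γ)
    (hωconv : ConvexOn ℝ Set.univ ω)
    (hbdd : BddBelow (Set.range ω))
    (hlev : ∀ α : ℝ, (⨅ z, ω z) ≤ α →
      IsClosed {x | ω x ≤ α} ∧ {x | ω x ≤ α}.Nonempty)
    (heb : ∀ (x : EuclideanSpace ℝ (Fin n)) (α : ℝ), (⨅ z, ω z) ≤ α →
      Metric.infDist x {y | ω y ≤ α} ^ κ ≤ γ * max (ω x - α) 0) :
    ∀ α : ℝ, (⨅ z, ω z) ≤ α → α ≤ ω xstar →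
      (sInf (f '' {x | ω x ≤ α}) ≤
        f xstar + L / 2 * (γ * (ω xstar - α)) ^ ((2 : ℝ) / κ)) ∧
      (∀ φbar : ℝ, f xstar ≤ φbar → ∀ ρ : ℝ, 0 < ρ →
        ρ ≤ sInf (f '' {x | ω x ≤ α}) - φbar →
        α + 1 / γ * (2 * ρ / L) ^ (κ / 2) ≤ ω xstar) := by
  intro α hα hαs
  have key : sInf (f '' {x | ω x ≤ α}) ≤
        f xstar + L / 2 * (γ * (ω xstar - α)) ^ ((2 : ℝ) / κ) := by
    obtain ⟨hc, hne⟩ := hlev α hα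
    obtain ⟨p, hp, hpd⟩ := hc.exists_infDist_eq_dist hne xstar
    have h1 := heb xstar α hα
    rw [max_eq_left (sub_nonneg.2 hαs), hpd] at h1
    have h2 := Real.rpow_le_rpow (by positivity) h1 (by positivity : 0 ≤ 2 / κ)
    rw [← Real.rpow_mul dist_nonneg, mul_div_cancel₀ _ hκ0.ne', dist_comm, dist_eq_norm,
      Real.rpow_two] at h2
    have h3 := descent_aux L f f' hf' hlip xstar hxstar p
    have h4 : sInf (f '' {x | ω x ≤ α}) ≤ f p :=
      csInf_le ⟨f xstar, by rintro _ ⟨z, _, rfl⟩; exact hxstar z⟩ ⟨p, hp, rfl⟩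
    have h5 := mul_le_mul_of_nonneg_left h2 (by positivity : 0 ≤ L / 2)
    linarith
  refine ⟨key, fun φ hφ ρ hρ hρh => ?_⟩
  have hnn : 0 ≤ γ * (ω xstar - α) := mul_nonneg hγ.le (sub_nonneg.2 hαs)
  have h1 : 2 * ρ / L ≤ (γ * (ω xstar - α)) ^ ((2 : ℝ) / κ) := by
    rw [div_le_iff₀ hL]
    linarith
  have h2 := Real.rpow_le_rpow (by positivity) h1 (by positivity : 0 ≤ κ / 2)
  rw [← Real.rpow_mul hnn, show (2 : ℝ) / κ * (κ / 2) = 1 by field_simp, Real.rpow_one] at h2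
  have h3 : 1 / γ * (2 * ρ / L) ^ (κ / 2) ≤ ω xstar - α := by
    rw [one_div, inv_mul_le_iff₀ hγ]
    exact h2
  linarith
end

section
/- Let (ξ_p)_{p ≥ 1} be a sequence of nonnegative real numbers and let η > 0 be such that ξ_{p+1} ≤ ξ_p − η ξ_{p+1}² for every p ≥ 1. Then for every p ≥ 1, ξ_p ≤ max{2/η, ξ₁} / p. -/
/-- Lemma 4.6: if a nonnegative sequence `(ξ_p)_{p ≥ 1}` satisfies
`ξ_{p+1} ≤ ξ_p − η ξ_{p+1}²` with `η > 0`, then `ξ_p ≤ max{2/η, ξ₁}/p` for all `p ≥ 1`. -/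
theorem decreasing_sequence_bound (ξ : ℕ → ℝ) (η : ℝ) (hη : 0 < η)
    (hnn : ∀ p : ℕ, 1 ≤ p → 0 ≤ ξ p)
    (hrec : ∀ p : ℕ, 1 ≤ p → ξ (p + 1) ≤ ξ p - η * ξ (p + 1) ^ 2) :
    ∀ p : ℕ, 1 ≤ p → ξ p ≤ max (2 / η) (ξ 1) / (p : ℝ) := by
  intro p hp
  have hM : 2 ≤ η * max (2 / η) (ξ 1) := by
    have h := mul_le_mul_of_nonneg_left (le_max_left (2 / η) (ξ 1)) hη.le
    rwa [mul_div_cancel₀ _ hη.ne'] at h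
  have hM1 : ξ 1 ≤ max (2 / η) (ξ 1) := le_max_right _ _
  generalize max (2 / η) (ξ 1) = M at hM hM1
  induction p, hp using Nat.le_induction with
  | base => simpa using hM1
  | succ p hp ih =>
    have hp1 : (1 : ℝ) ≤ p := by exact_mod_cast hp
    have hr := hrec p hp
    rw [le_div_iff₀ (by linarith)] at ih
    have hM0 : 0 < M := by
      by_contra h
      nlinarith
    push_cast
    by_contra hlt
    push Not at hlt
    have hy0 : 0 < M / ((p : ℝ) + 1) := by positivity
    have hMy : M = M / ((p : ℝ) + 1) * (p + 1) := by field_simp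
    generalize M / ((p : ℝ) + 1) = y at *
    generalize ξ (p + 1) = x at *
    have h1 : y ^ 2 ≤ x ^ 2 := by nlinarith
    have h2 : η * y ^ 2 ≤ η * x ^ 2 := mul_le_mul_of_nonneg_left h1 hη.le
    have h3 : y + η * y ^ 2 < ξ p := by linarith
    have h4 : (y + η * y ^ 2) * p < y * (p + 1) := by
      have := mul_lt_mul_of_pos_right h3 (by linarith : (0 : ℝ) < p)
      linarith
    have h5 : η * y * p < 1 := by
      by_contra h
      push Not at h
      nlinarith [mul_le_mul_of_nonneg_left h hy0.le]
    have h6 : 0 < η * y := mul_pos hη hy0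
    rw [hMy] at hM
    nlinarith [mul_le_mul_of_nonneg_left hp1 h6.le]
end

section
/- Let (ξ_p)_{p ≥ 0} be a sequence of nonnegative real numbers, let η₁ ∈ (0,1) and η₂ > 0, and suppose that for every p ≥ 1, ξ_p ≤ ξ_{p−1} − min{ η₁ ξ_{p−1}, η₂ ξ_{p−1}² }. Then for every ε > 0 there exists an index p ≤ K₁ + K₂ with ξ_p ≤ ε/4, where K₁ = max{0, ⌈ log( min{η₂/η₁, 4/ε} · ξ₀ ) / log(1/(1−η₁)) ⌉} and K₂ = ⌈ 8 / (η₂ ε) ⌉. -/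
/-- sufficient-decrease recursion, core of Theorem 4.7: a
nonnegative sequence satisfying `ξ_p ≤ ξ_{p−1} − min{η₁ξ_{p−1}, η₂ξ_{p−1}²}`
reaches `ε/4` within `K₁ + K₂` steps, where
`K₁ = max{0, ⌈log(min{η₂/η₁, 4/ε}·ξ₀)/log(1/(1−η₁))⌉}` and `K₂ = ⌈8/(η₂ε)⌉`. -/
theorem sufficient_decrease_recursion (ξ : ℕ → ℝ) (η₁ η₂ : ℝ)
    (hη₁0 : 0 < η₁) (hη₁1 : η₁ < 1) (hη₂ : 0 < η₂)
    (hnn : ∀ p : ℕ, 0 ≤ ξ p)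
    (hrec : ∀ p : ℕ, 1 ≤ p → ξ p ≤ ξ (p - 1) - min (η₁ * ξ (p - 1)) (η₂ * ξ (p - 1) ^ 2)) :
    ∀ ε : ℝ, 0 < ε →
      ∃ p : ℕ,
        (p : ℤ) ≤
            max 0 ⌈Real.log (min (η₂ / η₁) (4 / ε) * ξ 0) / Real.log (1 / (1 - η₁))⌉
          + ⌈8 / (η₂ * ε)⌉ ∧
        ξ p ≤ ε / 4 := by
  intro ε hε
  have hr : ∀ n, ξ (n+1) ≤ ξ n - min (η₁ * ξ n) (η₂ * ξ n ^ 2) := fun n => by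
    simpa using hrec (n+1) (by omega)
  have hmono : ∀ n, ξ (n+1) ≤ ξ n := fun n => by
    have h0 := hnn n
    have : 0 ≤ min (η₁ * ξ n) (η₂ * ξ n ^ 2) := le_min (by positivity) (by positivity)
    linarith [hr n]
  have hanti : Antitone ξ := antitone_nat_of_succ_le hmono
  have hq : 0 < 1 - η₁ := by linarith
  set m := min (η₂ / η₁) (4 / ε) with hm
  have hm0 : 0 < m := lt_min (by positivity) (by positivity)
  have hgeo : ∀ n, m * ξ n ≤ 1 ∨ ξ n ≤ (1 - η₁) ^ n * ξ 0 := by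
    intro n
    induction n with
    | zero => right; simp
    | succ n ih =>
      by_cases hc : m * ξ n ≤ 1
      · left
        exact (mul_le_mul_of_nonneg_left (hmono n) hm0.le).trans hc
      · right
        have ih' := ih.resolve_left hc
        push Not at hc
        have h1 : 1 < η₂ / η₁ * ξ n :=
          hc.trans_le (mul_le_mul_of_nonneg_right (min_le_left _ _) (hnn n))
        have h2 : η₁ < η₂ * ξ n := by
          rw [div_mul_eq_mul_div, lt_div_iff₀ hη₁0] at h1
          linarith
        have h3 : η₁ * ξ n ≤ η₂ * ξ n ^ 2 := by nlinarith [hnn n]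
        have h4 := hr n
        rw [min_eq_left h3] at h4
        calc ξ (n+1) ≤ (1 - η₁) * ξ n := by linarith
          _ ≤ (1 - η₁) * ((1 - η₁) ^ n * ξ 0) := mul_le_mul_of_nonneg_left ih' hq.le
          _ = _ := by ring
  set L := Real.log (m * ξ 0) / Real.log (1 / (1 - η₁)) with hL
  have hl : 0 < Real.log (1 / (1 - η₁)) := Real.log_pos (by rw [lt_div_iff₀ hq]; linarith)
  obtain ⟨N, hN⟩ := Int.eq_ofNat_of_zero_le (le_max_left 0 ⌈L⌉)
  obtain ⟨M, hM⟩ := Int.eq_ofNat_of_zero_le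
    (Int.ceil_nonneg (show 0 ≤ 8 / (η₂ * ε) by positivity))
  have hNL : L ≤ N := by
    have h1 : ⌈L⌉ ≤ (N : ℤ) := by rw [← hN]; exact le_max_right _ _
    exact_mod_cast Int.ceil_le.mp h1
  have hMK : 8 / (η₂ * ε) ≤ M := by
    have h1 : ⌈8 / (η₂ * ε)⌉ ≤ (M : ℤ) := hM.le
    exact_mod_cast Int.ceil_le.mp h1
  have hP1 : m * ξ N ≤ 1 := by
    rcases hgeo N with h | h
    · exact h
    rcases (hnn 0).eq_or_lt with h0 | h0
    · rw [← h0, mul_zero] at h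
      nlinarith
    have h1 : Real.log (m * ξ 0) ≤ N * Real.log (1 / (1 - η₁)) := by
      rwa [hL, div_le_iff₀ hl] at hNL
    rw [← Real.log_pow] at h1
    have h2 := (Real.log_le_log_iff (by positivity) (by positivity)).mp h1
    rw [div_pow, one_pow, le_div_iff₀ (by positivity)] at h2
    calc m * ξ N ≤ m * ((1 - η₁) ^ N * ξ 0) := mul_le_mul_of_nonneg_left h hm0.le
      _ = m * ξ 0 * (1 - η₁) ^ N := by ring
      _ ≤ 1 := h2
  refine ⟨N + M, by rw [hN, hM]; push_cast; exact le_rfl, ?_⟩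
  rcases min_choice (η₂ / η₁) (4 / ε) with hc | hc
  · rw [hm, hc, div_mul_eq_mul_div, div_le_one hη₁0] at hP1
    have hsub : ∀ n : ℕ, η₂ * ξ (N + n) * n ≤ 1 := by
      intro n
      induction n with
      | zero => simp
      | succ n ih =>
        have h0 := hnn (N + n)
        have h1 : η₂ * ξ (N + n) ≤ η₁ :=
          (mul_le_mul_of_nonneg_left (hanti (by omega)) hη₂.le).trans hP1
        have h2 : η₂ * ξ (N + n) ^ 2 ≤ η₁ * ξ (N + n) := by nlinarith
        have h3 := hr (N + n)
        rw [min_eq_right h2] at h3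
        have h4 : η₂ * ξ (N + (n + 1)) ≤
            η₂ * ξ (N + n) * (1 - η₂ * ξ (N + n)) := by
          have := mul_le_mul_of_nonneg_left h3 hη₂.le
          rw [← add_assoc]
          linarith
        set x := η₂ * ξ (N + n) with hx
        have h5 := mul_le_mul_of_nonneg_right h4 (show (0:ℝ) ≤ (n:ℝ) + 1 by positivity)
        have h6 := mul_le_mul_of_nonneg_right ih (show 0 ≤ 1 - x by linarith)
        push_cast
        nlinarith [sq_nonneg x]
    have h1 := hsub M
    have h0 := hnn (N + M)
    have h2 : 8 ≤ M * (η₂ * ε) := by rwa [div_le_iff₀ (by positivity)] at hMK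
    by_contra hcon
    push Not at hcon
    have h3 : η₂ * M * (ε / 4) ≤ η₂ * M * ξ (N + M) :=
      mul_le_mul_of_nonneg_left hcon.le (by positivity)
    linarith
  · rw [hm, hc, div_mul_eq_mul_div, div_le_one hε] at hP1
    have := hanti (show N ≤ N + M by omega)
    linarith
end

section
/- Let n ≥ 1 and L > 0. Let f : ℝⁿ → ℝ be convex and differentiable with L-Lipschitz continuous gradient, let g : ℝⁿ → ℝ ∪ {+∞} be proper closed convex, and set φ = f + g. Suppose x⋆ is a global minimizer of φ with φ* = φ(x⋆). Let x ∈ dom(g), and let D ≥ 0 satisfy ‖u − v‖ ≤ D for all u, v ∈ ℝⁿ with φ(u) ≤ φ(x) and φ(v) ≤ φ(x). Let x⁺ be a minimizer over ℝⁿ of the function u ↦ f(x) + ⟨∇f(x), u − x⟩ + (L/2)‖u − x‖² + g(u) (the proximal-gradient point of x with step size 1/L). Then φ(x) − φ* ≤ 2 · max{ φ(x) − φ(x⁺), √( (L/2) · D² · (φ(x) − φ(x⁺)) ) }. -/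
open RealInnerProductSpace in
lemma pg_line {E : Type*} [NormedAddCommGroup E] [InnerProductSpace ℝ E] [CompleteSpace E]
    (f : E → ℝ) (f' : E → E) (hf' : ∀ x, HasGradientAt f (f' x) x) (x d : E) (t : ℝ) :
    HasDerivAt (fun t : ℝ => f (x + t • d)) ⟪f' (x + t • d), d⟫ t := by
  have h1 : HasDerivAt (fun t : ℝ => x + t • d) d t := by
    simpa using ((hasDerivAt_id t).smul_const d).const_add x
  have h2 := (hf' (x + t • d)).hasFDerivAt.comp_hasDerivAt t h1
  simpa [Function.comp_def] using h2

open RealInnerProductSpace in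
lemma pg_convex {E : Type*} [NormedAddCommGroup E] [InnerProductSpace ℝ E] [CompleteSpace E]
    (f : E → ℝ) (f' : E → E) (hf' : ∀ x, HasGradientAt f (f' x) x)
    (hc : ConvexOn ℝ Set.univ f) (x d : E) :
    f x + ⟪f' x, d⟫ ≤ f (x + d) := by
  have hk : ConvexOn ℝ Set.univ (fun t : ℝ => f (x + t • d)) := by
    refine ⟨convex_univ, ?_⟩
    intro a _ b _ p q hp hq hpq
    have := hc.2 (Set.mem_univ (x + a • d)) (Set.mem_univ (x + b • d)) hp hq hpq
    have e : p • (x + a • d) + q • (x + b • d) = x + (p • a + q • b) • d := by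
      have : x = (p + q) • x := by rw [hpq, one_smul]
      conv_rhs => rw [this]
      simp only [smul_eq_mul]
      module
    rw [e] at this
    exact this
  have h := hk.le_slope_of_hasDerivAt (Set.mem_univ 0) (Set.mem_univ 1) one_pos
    (pg_line f f' hf' x d 0)
  simp [slope_def_field] at h
  linarith

open RealInnerProductSpace in
lemma pg_descent {E : Type*} [NormedAddCommGroup E] [InnerProductSpace ℝ E] [CompleteSpace E]
    (f : E → ℝ) (f' : E → E) (hf' : ∀ x, HasGradientAt f (f' x) x) (L : ℝ)
    (hlip : ∀ x y, ‖f' x - f' y‖ ≤ L * ‖x - y‖) (x d : E) :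
    f (x + d) ≤ f x + ⟪f' x, d⟫ + L / 2 * ‖d‖ ^ 2 := by
  have hd : ∀ t : ℝ, HasDerivAt
      (fun t : ℝ => f (x + t • d) - t * ⟪f' x, d⟫ - t ^ 2 * (L / 2 * ‖d‖ ^ 2))
      (⟪f' (x + t • d), d⟫ - ⟪f' x, d⟫ - t * (L * ‖d‖ ^ 2)) t := by
    intro t
    have h := ((pg_line f f' hf' x d t).sub ((hasDerivAt_id t).mul_const ⟪f' x, d⟫)).sub
      ((hasDerivAt_pow 2 t).mul_const (L / 2 * ‖d‖ ^ 2))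
    refine HasDerivAt.congr_deriv h ?_
    norm_num
    ring
  have ha := antitoneOn_of_deriv_nonpos (convex_Icc (0 : ℝ) 1)
    (fun t _ => (hd t).continuousAt.continuousWithinAt)
    (fun t _ => (hd t).differentiableAt.differentiableWithinAt)
    (by
      intro t ht
      rw [interior_Icc] at ht
      rw [(hd t).deriv, ← inner_sub_left]
      have h1 := real_inner_le_norm (f' (x + t • d) - f' x) d
      have h2 := hlip (x + t • d) x
      rw [add_sub_cancel_left, norm_smul, Real.norm_of_nonneg ht.1.le] at h2
      have h3 := mul_le_mul_of_nonneg_right h2 (norm_nonneg d)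
      nlinarith)
  have h := ha (Set.left_mem_Icc.2 zero_le_one) (Set.right_mem_Icc.2 zero_le_one) zero_le_one
  simp at h
  linarith

open RealInnerProductSpace in
/-- Lemma 2.4: proximal-gradient optimality measure bound for a
composite objective `φ = f + g`, with `f` convex, differentiable with `L`-Lipschitz
gradient and `g` proper closed convex with effective domain `S`.  If the level set
`{u : φ(u) ≤ φ(x)}` has diameter at most `D` and `x⁺` minimizes the prox model of
`φ` at `x` with step `1/L`, then
`φ(x) − φ* ≤ 2·max{φ(x) − φ(x⁺), √((L/2)D²(φ(x) − φ(x⁺)))}`. -/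
theorem prox_grad_optimality_measure (n : ℕ) (hn : 1 ≤ n) (L : ℝ) (hL : 0 < L)
    (f g : EuclideanSpace ℝ (Fin n) → ℝ)
    (f' : EuclideanSpace ℝ (Fin n) → EuclideanSpace ℝ (Fin n))
    (S : Set (EuclideanSpace ℝ (Fin n))) (hS : S.Nonempty)
    (hfconv : ConvexOn ℝ Set.univ f)
    (hf' : ∀ x, HasGradientAt f (f' x) x)
    (hlip : ∀ x y, ‖f' x - f' y‖ ≤ L * ‖x - y‖)
    (hgconv : ConvexOn ℝ S g)
    (hgclosed : IsClosed {p : EuclideanSpace ℝ (Fin n) × ℝ | p.1 ∈ S ∧ g p.1 ≤ p.2})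
    (xstar : EuclideanSpace ℝ (Fin n)) (hxstarS : xstar ∈ S)
    (hxstar : ∀ y ∈ S, f xstar + g xstar ≤ f y + g y)
    (x : EuclideanSpace ℝ (Fin n)) (hx : x ∈ S)
    (D : ℝ) (hD0 : 0 ≤ D)
    (hD : ∀ u ∈ S, ∀ v ∈ S,
      f u + g u ≤ f x + g x → f v + g v ≤ f x + g x → ‖u - v‖ ≤ D)
    (xp : EuclideanSpace ℝ (Fin n)) (hxpS : xp ∈ S)
    (hxp : ∀ u ∈ S,
      f x + ⟪f' x, xp - x⟫ + L / 2 * ‖xp - x‖ ^ 2 + g xp ≤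
        f x + ⟪f' x, u - x⟫ + L / 2 * ‖u - x‖ ^ 2 + g u) :
    f x + g x - (f xstar + g xstar) ≤
      2 * max (f x + g x - (f xp + g xp))
        (Real.sqrt (L / 2 * D ^ 2 * (f x + g x - (f xp + g xp)))) := by
  have key : ∀ t : ℝ, 0 ≤ t → t ≤ 1 →
      t * (f x + g x - (f xstar + g xstar)) - t ^ 2 * (L / 2 * D ^ 2) ≤
        f x + g x - (f xp + g xp) := by
    intro t h0 h1
    have hdesc := pg_descent f f' hf' L hlip x (xp - x)
    rw [add_sub_cancel] at hdesc
    have hgr := pg_convex f f' hf' hfconv x (xstar - x)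
    rw [add_sub_cancel] at hgr
    have hu := hgconv.1 hx hxstarS (sub_nonneg.2 h1) h0 (by ring)
    have hg := hgconv.2 hx hxstarS (sub_nonneg.2 h1) h0 (by ring)
    have hm := hxp _ hu
    have e : (1 - t) • x + t • xstar - x = t • (xstar - x) := by module
    rw [e, inner_smul_right, norm_smul, Real.norm_of_nonneg h0] at hm
    have hR := hD xstar hxstarS x hx (hxstar x hx) le_rfl
    have hR2 : ‖xstar - x‖ ^ 2 ≤ D ^ 2 := pow_le_pow_left₀ (norm_nonneg _) hR 2
    have hR3 : t ^ 2 * (L / 2 * ‖xstar - x‖ ^ 2) ≤ t ^ 2 * (L / 2 * D ^ 2) := by gcongr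
    have hgr2 := mul_le_mul_of_nonneg_left hgr h0
    simp only [smul_eq_mul] at hg
    rw [mul_pow] at hm
    linarith
  have hΔ := hxstar x hx
  set Δ := f x + g x - (f xstar + g xstar) with hΔd
  set δ := f x + g x - (f xp + g xp) with hδd
  set a := L / 2 * D ^ 2 with had
  have hΔ0 : 0 ≤ Δ := by linarith
  by_cases hc : 2 * a ≤ Δ
  · have := key 1 zero_le_one le_rfl
    have := le_max_left δ (Real.sqrt (a * δ))
    linarith
  · push Not at hc
    have ha : 0 < a := by linarith
    have h := key (Δ / (2 * a)) (by positivity) ((div_le_one (by positivity)).2 hc.le)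
    have e : Δ / (2 * a) * Δ - (Δ / (2 * a)) ^ 2 * a = (Δ / 2) ^ 2 / a := by
      field_simp
      ring
    rw [e, div_le_iff₀ ha] at h
    have h2 : Δ / 2 ≤ Real.sqrt (a * δ) := Real.le_sqrt_of_sq_le (by linarith)
    have := le_max_right δ (Real.sqrt (a * δ))
    linarith
end

section
/- Let n ≥ 1. Let φ : ℝⁿ → ℝ ∪ {+∞} satisfy φ(u) ≥ φ* for all u ∈ ℝⁿ, where φ* ∈ ℝ. Let ω : ℝⁿ → ℝ, α ∈ ℝ, and D ≥ 0 be such that ‖a − b‖ ≤ D for all a, b ∈ Lev_ω(α). Let c ∈ ℝ, and let u₁, u₂, v₁, v₂ ∈ ℝⁿ satisfy ω(u₂) ≤ α, ω(v₂) ≤ α, φ(u₁) + ‖u₁ − u₂‖² ≤ c, and φ(v₁) + ‖v₁ − v₂‖² ≤ c. Then ‖u₁ − v₁‖² ≤ 6(c − φ*) + 3D², and consequently ‖u₁ − v₁‖² + ‖u₂ − v₂‖² ≤ 6(c − φ*) + 4D². -/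
/-- Lemma 4.12: diameter bound for level sets of the penalized
function `φ̂^α(y₁,y₂) = φ(y₁) + ‖y₁ − y₂‖² + δ_{Lev_ω(α)}(y₂)`.  Here `φ` is
extended-real-valued with effective domain `S` and lower bound `φ*`, and the level
set `Lev_ω(α)` has diameter at most `D`. -/
theorem penalized_level_set_diameter (n : ℕ) (hn : 1 ≤ n)
    (φ ω : EuclideanSpace ℝ (Fin n) → ℝ)
    (S : Set (EuclideanSpace ℝ (Fin n))) (φstar : ℝ)
    (hlb : ∀ u ∈ S, φstar ≤ φ u)
    (α D c : ℝ) (hD0 : 0 ≤ D)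
    (hD : ∀ a ∈ {y : EuclideanSpace ℝ (Fin n) | ω y ≤ α},
          ∀ b ∈ {y : EuclideanSpace ℝ (Fin n) | ω y ≤ α}, ‖a - b‖ ≤ D)
    (u₁ u₂ v₁ v₂ : EuclideanSpace ℝ (Fin n))
    (hu₁ : u₁ ∈ S) (hv₁ : v₁ ∈ S)
    (hu₂ : ω u₂ ≤ α) (hv₂ : ω v₂ ≤ α)
    (hu : φ u₁ + ‖u₁ - u₂‖ ^ 2 ≤ c) (hv : φ v₁ + ‖v₁ - v₂‖ ^ 2 ≤ c) :
    ‖u₁ - v₁‖ ^ 2 ≤ 6 * (c - φstar) + 3 * D ^ 2 ∧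
    ‖u₁ - v₁‖ ^ 2 + ‖u₂ - v₂‖ ^ 2 ≤ 6 * (c - φstar) + 4 * D ^ 2 := by
  have h1 := hlb u₁ hu₁
  have h2 := hlb v₁ hv₁
  have h3 : ‖u₂ - v₂‖ ≤ D := hD u₂ hu₂ v₂ hv₂
  have h4 : ‖u₂ - v₂‖ ^ 2 ≤ D ^ 2 := pow_le_pow_left₀ (norm_nonneg _) h3 2
  have h5 : ‖u₁ - v₁‖ ≤ ‖u₁ - u₂‖ + ‖u₂ - v₂‖ + ‖v₁ - v₂‖ := by
    have e : u₁ - v₁ = (u₁ - u₂) + (u₂ - v₂) + (v₂ - v₁) := by abel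
    rw [e, norm_sub_rev v₁ v₂]
    exact norm_add₃_le
  have h6 : ‖u₁ - v₁‖ ^ 2 ≤ (‖u₁ - u₂‖ + ‖u₂ - v₂‖ + ‖v₁ - v₂‖) ^ 2 :=
    pow_le_pow_left₀ (norm_nonneg _) h5 2
  have h7 : ‖u₁ - v₁‖ ^ 2 ≤ 6 * (c - φstar) + 3 * D ^ 2 := by
    nlinarith [sq_nonneg (‖u₁ - u₂‖ - ‖u₂ - v₂‖), sq_nonneg (‖u₂ - v₂‖ - ‖v₁ - v₂‖),
      sq_nonneg (‖u₁ - u₂‖ - ‖v₁ - v₂‖)]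
  exact ⟨h7, by linarith⟩
end

section
/- Let n ≥ 1 and let ω : ℝⁿ → ℝ be convex with compact nonempty level sets and a κ-power γ-global error bound for some κ ∈ (0,2] and γ > 0. Let α₀, ω*, ω̄ ∈ ℝ with inf ω ≤ α₀ ≤ ω* ≤ ω̄, and let ε > 0. Let x ∈ ℝⁿ satisfy dist(x, Lev_ω(ω*)) ≤ √ε, and let x̃ be the orthogonal projection of x onto the (closed convex nonempty) set Lev_ω(ω*). Define W⁰ = { y ∈ ℝⁿ : dist(y, Lev_ω(α₀)) ≤ (γ(ω̄ − α₀))^{1/κ} + √ε }. Then: (i) x ∈ W⁰ and x̃ ∈ W⁰; (ii) if moreover ω is Lipschitz continuous on W⁰ with constant ℓ, then ω(x) − ω* ≤ ℓ · √ε. -/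
/-- outer-function gap part of Corollary 3.4: let `ω` be convex
with compact level sets (nonempty at `α₀`) and a κ-power γ-global error bound,
`α₀ ≤ ω* ≤ ω̄`, `ε > 0`, `dist(x, Lev_ω(ω*)) ≤ √ε`, and let `x̃` be the orthogonal
projection of `x` onto `Lev_ω(ω*)`.  With
`W⁰ = {y : dist(y, Lev_ω(α₀)) ≤ (γ(ω̄ − α₀))^{1/κ} + √ε}`:
(i) `x, x̃ ∈ W⁰`; (ii) if `ω` is `ℓ`-Lipschitz on `W⁰` then `ω(x) − ω* ≤ ℓ√ε`. -/
theorem outer_gap_bound (n : ℕ) (hn : 1 ≤ n)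
    (κ γ : ℝ) (hκ0 : 0 < κ) (hκ2 : κ ≤ 2) (hγ : 0 < γ)
    (ω : EuclideanSpace ℝ (Fin n) → ℝ)
    (hωconv : ConvexOn ℝ Set.univ ω)
    (hcompact : ∀ α : ℝ, IsCompact {x | ω x ≤ α})
    (heb : ∀ (x : EuclideanSpace ℝ (Fin n)) (α : ℝ), {y | ω y ≤ α}.Nonempty →
      Metric.infDist x {y | ω y ≤ α} ^ κ ≤ γ * max (ω x - α) 0)
    (α₀ ωstar ωbar : ℝ)
    (hα₀ne : {x | ω x ≤ α₀}.Nonempty)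
    (hαω : α₀ ≤ ωstar) (hωω : ωstar ≤ ωbar)
    (ε : ℝ) (hε : 0 < ε)
    (x : EuclideanSpace ℝ (Fin n))
    (hx : Metric.infDist x {y | ω y ≤ ωstar} ≤ Real.sqrt ε)
    (xt : EuclideanSpace ℝ (Fin n)) (hxtmem : ω xt ≤ ωstar)
    (hxtproj : dist x xt = Metric.infDist x {y | ω y ≤ ωstar}) :
    (x ∈ {y : EuclideanSpace ℝ (Fin n) |
        Metric.infDist y {z | ω z ≤ α₀} ≤ (γ * (ωbar - α₀)) ^ ((1 : ℝ) / κ) + Real.sqrt ε} ∧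
     xt ∈ {y : EuclideanSpace ℝ (Fin n) |
        Metric.infDist y {z | ω z ≤ α₀} ≤ (γ * (ωbar - α₀)) ^ ((1 : ℝ) / κ) + Real.sqrt ε}) ∧
    (∀ ℓ : ℝ,
      (∀ a ∈ {y : EuclideanSpace ℝ (Fin n) |
          Metric.infDist y {z | ω z ≤ α₀} ≤ (γ * (ωbar - α₀)) ^ ((1 : ℝ) / κ) + Real.sqrt ε},
       ∀ b ∈ {y : EuclideanSpace ℝ (Fin n) |
          Metric.infDist y {z | ω z ≤ α₀} ≤ (γ * (ωbar - α₀)) ^ ((1 : ℝ) / κ) + Real.sqrt ε},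
        |ω a - ω b| ≤ ℓ * ‖a - b‖) →
      ω x - ωstar ≤ ℓ * Real.sqrt ε) := by
  have hC : 0 ≤ γ * (ωbar - α₀) := mul_nonneg hγ.le (by linarith)
  have hR : 0 ≤ (γ * (ωbar - α₀)) ^ ((1 : ℝ) / κ) := Real.rpow_nonneg hC _
  have hs : 0 < Real.sqrt ε := Real.sqrt_pos.mpr hε
  have h1 : Metric.infDist xt {z | ω z ≤ α₀} ≤ (γ * (ωbar - α₀)) ^ ((1 : ℝ) / κ) := by
    have h := heb xt α₀ hα₀ne
    have h2 : Metric.infDist xt {z | ω z ≤ α₀} ^ κ ≤ γ * (ωbar - α₀) :=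
      h.trans (mul_le_mul_of_nonneg_left (max_le (by linarith) (by linarith)) hγ.le)
    have h3 := Real.rpow_le_rpow (Real.rpow_nonneg Metric.infDist_nonneg κ) h2
      (by positivity : (0 : ℝ) ≤ 1 / κ)
    rwa [← Real.rpow_mul Metric.infDist_nonneg, mul_one_div_cancel hκ0.ne',
      Real.rpow_one] at h3
  have hd : dist x xt ≤ Real.sqrt ε := hxtproj ▸ hx
  have hxW : Metric.infDist x {z | ω z ≤ α₀}
      ≤ (γ * (ωbar - α₀)) ^ ((1 : ℝ) / κ) + Real.sqrt ε := by
    have := Metric.infDist_le_infDist_add_dist (s := {z | ω z ≤ α₀}) (x := x) (y := xt)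
    linarith
  have hxtW : Metric.infDist xt {z | ω z ≤ α₀}
      ≤ (γ * (ωbar - α₀)) ^ ((1 : ℝ) / κ) + Real.sqrt ε := by linarith
  refine ⟨⟨hxW, hxtW⟩, fun ℓ hL => ?_⟩
  have hℓ : 0 ≤ ℓ := by
    obtain ⟨p, hp⟩ := hα₀ne
    let v : EuclideanSpace ℝ (Fin n) := EuclideanSpace.single ⟨0, hn⟩ (Real.sqrt ε)
    have hv : ‖v‖ = Real.sqrt ε := by
      simp [v, abs_of_pos hs]
    have hb := hL (p + v) (by
      have h := Metric.infDist_le_dist_of_mem (x := p + v) hp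
      have h' : dist (p + v) p = Real.sqrt ε := by rw [dist_eq_norm, add_sub_cancel_left, hv]
      rw [Set.mem_setOf_eq]
      linarith) p (by
      have h := Metric.infDist_zero_of_mem hp
      rw [Set.mem_setOf_eq]
      linarith)
    rw [add_sub_cancel_left, hv] at hb
    exact nonneg_of_mul_nonneg_left ((abs_nonneg _).trans hb) hs
  have h := hL x hxW xt hxtW
  rw [← dist_eq_norm] at h
  have h4 := mul_le_mul_of_nonneg_left hd hℓ
  have h5 := le_abs_self (ω x - ω xt)
  linarith
end

section
/- Let n ≥ 1, x₀ ∈ ℝⁿ, and p ∈ [1, 2]. Define ω(x) = ‖x − x₀‖_p = (Σ_{i=1}^n |x_i − (x₀)_i|^p)^{1/p}. Then for every α ≥ 0 and every x ∈ ℝⁿ, the Euclidean distance from x to the set {y ∈ ℝⁿ : ‖y − x₀‖_p ≤ α} satisfies dist(x, Lev_ω(α)) ≤ max(‖x − x₀‖_p − α, 0). -/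
/-- Table 2, ℓ_p-norm entry, `1 ≤ p ≤ 2`: the function
`ω(x) = ‖x − x₀‖_p` has a 1-power global error bound with constant `γ = 1`:
for every `α ≥ 0` and `x`, `dist(x, Lev_ω(α)) ≤ [ω(x) − α]₊`, where `dist` is the
Euclidean distance. -/
theorem lp_error_bound_small_p (n : ℕ) (hn : 1 ≤ n)
    (x₀ : EuclideanSpace ℝ (Fin n)) (p : ℝ) (hp1 : 1 ≤ p) (hp2 : p ≤ 2)
    (ω : EuclideanSpace ℝ (Fin n) → ℝ)
    (hω : ∀ x, ω x = (∑ i, |x i - x₀ i| ^ p) ^ (1 / p)) :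
    ∀ α : ℝ, 0 ≤ α → ∀ x : EuclideanSpace ℝ (Fin n),
      Metric.infDist x {y | ω y ≤ α} ≤ max (ω x - α) 0 := by
  intro α hα x
  have hp0 : 0 < p := by linarith
  rcases le_or_gt (ω x) α with h | h
  · rw [Metric.infDist_zero_of_mem (show x ∈ {y | ω y ≤ α} from h)]
    exact le_max_right _ _
  have hN : 0 < ω x := lt_of_le_of_lt hα h
  have hS0 : 0 ≤ ∑ i, |x i - x₀ i| ^ p :=
    Finset.sum_nonneg fun i _ => Real.rpow_nonneg (abs_nonneg _) _
  have hNp : ω x ^ p = ∑ i, |x i - x₀ i| ^ p := by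
    rw [hω x, ← Real.rpow_mul hS0, one_div_mul_cancel hp0.ne', Real.rpow_one]
  have hle : ∀ i, |x i - x₀ i| ≤ ω x := by
    intro i
    rw [← Real.rpow_le_rpow_iff (abs_nonneg _) hN.le hp0, hNp]
    exact Finset.single_le_sum (f := fun i => |x i - x₀ i| ^ p)
      (fun i _ => Real.rpow_nonneg (abs_nonneg _) _) (Finset.mem_univ i)
  have hsq : ∀ i, (x i - x₀ i) ^ 2 ≤ |x i - x₀ i| ^ p * ω x ^ (2 - p) := by
    intro i
    have h1 : (x i - x₀ i) ^ 2 = |x i - x₀ i| ^ p * |x i - x₀ i| ^ (2 - p) := by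
      rw [← Real.rpow_add_of_nonneg (abs_nonneg _) hp0.le (by linarith), ← sq_abs,
        ← Real.rpow_natCast]
      norm_num
    rw [h1]
    exact mul_le_mul_of_nonneg_left
      (Real.rpow_le_rpow (abs_nonneg _) (hle i) (by linarith))
      (Real.rpow_nonneg (abs_nonneg _) _)
  have hnorm : ‖x - x₀‖ ≤ ω x := by
    refine (sq_le_sq₀ (norm_nonneg _) hN.le).1 ?_
    rw [EuclideanSpace.norm_sq_eq]
    calc ∑ i, ‖(x - x₀) i‖ ^ 2 = ∑ i, (x i - x₀ i) ^ 2 := by simp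
      _ ≤ ∑ i, |x i - x₀ i| ^ p * ω x ^ (2 - p) := Finset.sum_le_sum fun i _ => hsq i
      _ = ω x ^ 2 := by
        rw [← Finset.sum_mul, ← hNp, ← Real.rpow_add hN, ← Real.rpow_natCast]
        norm_num
  have ht0 : 0 ≤ α / ω x := div_nonneg hα hN.le
  have ht1 : α / ω x ≤ 1 := (div_le_one hN).2 h.le
  have hmem : x₀ + (α / ω x) • (x - x₀) ∈ {y | ω y ≤ α} := by
    have : ω (x₀ + (α / ω x) • (x - x₀)) = α / ω x * ω x := by
      rw [hω (x₀ + (α / ω x) • (x - x₀))]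
      have : ∀ i, |(x₀ + (α / ω x) • (x - x₀)) i - x₀ i| ^ p
          = (α / ω x) ^ p * |x i - x₀ i| ^ p := by
        intro i
        rw [← Real.mul_rpow ht0 (abs_nonneg _)]
        congr 1
        simp only [PiLp.add_apply, PiLp.smul_apply, PiLp.sub_apply, smul_eq_mul,
          add_sub_cancel_left]
        rw [abs_mul, abs_of_nonneg ht0]
      rw [Finset.sum_congr rfl fun i _ => this i, ← Finset.mul_sum, ← hNp,
        ← Real.mul_rpow ht0 hN.le, ← Real.rpow_mul (mul_nonneg ht0 hN.le),
        mul_one_div_cancel hp0.ne', Real.rpow_one]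
    rw [Set.mem_setOf_eq, this, div_mul_cancel₀ _ hN.ne']
  refine (Metric.infDist_le_dist_of_mem hmem).trans (le_trans ?_ (le_max_left _ _))
  have he : x - (x₀ + (α / ω x) • (x - x₀)) = (1 - α / ω x) • (x - x₀) := by
    rw [sub_smul, one_smul]; abel
  rw [dist_eq_norm, he, norm_smul, Real.norm_of_nonneg (by linarith)]
  calc (1 - α / ω x) * ‖x - x₀‖ ≤ (1 - α / ω x) * ω x :=
        mul_le_mul_of_nonneg_left hnorm (by linarith)
    _ = ω x - α := by field_simp
end

section
/- Let n ≥ 1, x₀ ∈ ℝⁿ, and p > 2. Define ω(x) = ‖x − x₀‖_p = (Σ_{i=1}^n |x_i − (x₀)_i|^p)^{1/p}. Then for every α ≥ 0 and every x ∈ ℝⁿ, the Euclidean distance from x to the set {y ∈ ℝⁿ : ‖y − x₀‖_p ≤ α} satisfies dist(x, Lev_ω(α)) ≤ n^{1/2 − 1/p} · max(‖x − x₀‖_p − α, 0). -/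
lemma aux_norm (n : ℕ) (z : EuclideanSpace ℝ (Fin n)) (p : ℝ) (hp : 2 < p) :
    ‖z‖ ≤ (n : ℝ) ^ ((1 : ℝ) / 2 - 1 / p) * (∑ i, |z i| ^ p) ^ (1 / p) := by
  have hp0 : 0 < p := by linarith
  have h := Real.rpow_sum_le_const_mul_sum_rpow_of_nonneg (s := Finset.univ)
    (f := fun i => |z i| ^ 2) (p := p / 2) (by linarith) (fun i _ => by positivity)
  have e : ∀ i, (|z i| ^ 2) ^ (p / 2) = |z i| ^ p := fun i => by
    rw [← Real.rpow_natCast, ← Real.rpow_mul (abs_nonneg _)]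
    congr 1; push_cast; ring
  simp only [e, Finset.card_univ, Fintype.card_fin] at h
  have hs : 0 ≤ ∑ i, |z i| ^ 2 := by positivity
  have hS : 0 ≤ ∑ i, |z i| ^ p := Finset.sum_nonneg fun i _ => by positivity
  have h2 := Real.rpow_le_rpow (by positivity) h (by positivity : 0 ≤ 1 / p)
  rw [Real.mul_rpow (by positivity) hS, ← Real.rpow_mul hs,
    ← Real.rpow_mul (by positivity)] at h2
  have e1 : p / 2 * (1 / p) = 1 / 2 := by field_simp
  have e2 : (p / 2 - 1) * (1 / p) = 1 / 2 - 1 / p := by field_simp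
  rw [e1, e2] at h2
  rw [EuclideanSpace.norm_eq, Real.sqrt_eq_rpow]
  simpa only [Real.norm_eq_abs] using h2

/-- Table 2, ℓ_p-norm entry, `p > 2`: the function
`ω(x) = ‖x − x₀‖_p` has a 1-power global error bound with constant
`γ = n^{1/2 − 1/p}`: for every `α ≥ 0` and `x`,
`dist(x, Lev_ω(α)) ≤ n^{1/2 − 1/p}·[ω(x) − α]₊` (Euclidean distance). -/
theorem lp_error_bound_large_p (n : ℕ) (hn : 1 ≤ n)
    (x₀ : EuclideanSpace ℝ (Fin n)) (p : ℝ) (hp : 2 < p)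
    (ω : EuclideanSpace ℝ (Fin n) → ℝ)
    (hω : ∀ x, ω x = (∑ i, |x i - x₀ i| ^ p) ^ (1 / p)) :
    ∀ α : ℝ, 0 ≤ α → ∀ x : EuclideanSpace ℝ (Fin n),
      Metric.infDist x {y | ω y ≤ α} ≤
        (n : ℝ) ^ ((1 : ℝ) / 2 - 1 / p) * max (ω x - α) 0 := by
  intro α hα x
  have hp0 : 0 < p := by linarith
  rcases le_or_gt (ω x) α with hx | hx
  · rw [Metric.infDist_zero_of_mem (show x ∈ {y | ω y ≤ α} from hx)]
    positivity
  have hpos : 0 < ω x := lt_of_le_of_lt hα hx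
  obtain ⟨t, ht⟩ : ∃ t, t = α / ω x := ⟨_, rfl⟩
  have ht0 : 0 ≤ t := by rw [ht]; positivity
  have ht1 : t ≤ 1 := by rw [ht, div_le_one hpos]; exact hx.le
  have htw : t * ω x = α := by rw [ht]; field_simp
  have hy : ω (x₀ + t • (x - x₀)) = α := by
    rw [← htw, hω, hω x]
    have e : ∀ i, |(x₀ + t • (x - x₀)) i - x₀ i| ^ p = t ^ p * |x i - x₀ i| ^ p := fun i => by
      rw [← Real.mul_rpow ht0 (abs_nonneg _)]
      simp [abs_mul, abs_of_nonneg ht0]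
    simp only [e]
    rw [← Finset.mul_sum, Real.mul_rpow (by positivity)
      (Finset.sum_nonneg fun i _ => by positivity), ← Real.rpow_mul ht0,
      mul_one_div_cancel hp0.ne', Real.rpow_one]
  refine (Metric.infDist_le_dist_of_mem (show x₀ + t • (x - x₀) ∈ {y | ω y ≤ α} from hy.le)).trans ?_
  have hd : x - (x₀ + t • (x - x₀)) = (1 - t) • (x - x₀) := by module
  have hN := aux_norm n (x - x₀) p hp
  simp only [PiLp.sub_apply] at hN
  rw [← hω x] at hN
  rw [dist_eq_norm, hd, norm_smul, Real.norm_of_nonneg (by linarith),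
    max_eq_left (by linarith)]
  calc (1 - t) * ‖x - x₀‖ ≤ (1 - t) * ((n : ℝ) ^ ((1 : ℝ) / 2 - 1 / p) * ω x) :=
        mul_le_mul_of_nonneg_left hN (by linarith)
    _ = (n : ℝ) ^ ((1 : ℝ) / 2 - 1 / p) * (ω x - t * ω x) := by ring
    _ = _ := by rw [htw]
end

section
/- Let n ≥ 1 and ρ > 0, and define the elastic-net function ω(x) = ‖x‖₁ + ρ‖x‖₂² on ℝⁿ. Then for every α ≥ 0 and every x ∈ ℝⁿ, dist(x, Lev_ω(α))² ≤ (1/ρ) · max(ω(x) − α, 0), where dist is the Euclidean distance and Lev_ω(α) = {y : ω(y) ≤ α}. -/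
/-- Table 2, elastic-net entry, κ = 2: the elastic-net function
`ω(x) = ‖x‖₁ + ρ‖x‖₂²` has a 2-power global error bound with constant `1/ρ`:
`dist(x, Lev_ω(α))² ≤ (1/ρ)·[ω(x) − α]₊` for every `α ≥ 0` (Euclidean distance). -/
theorem elastic_net_error_bound_two (n : ℕ) (hn : 1 ≤ n) (ρ : ℝ) (hρ : 0 < ρ)
    (ω : EuclideanSpace ℝ (Fin n) → ℝ)
    (hω : ∀ x, ω x = (∑ i, |x i|) + ρ * ‖x‖ ^ 2) :
    ∀ α : ℝ, 0 ≤ α → ∀ x : EuclideanSpace ℝ (Fin n),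
      Metric.infDist x {y | ω y ≤ α} ^ 2 ≤ 1 / ρ * max (ω x - α) 0 := by
  intro α hα x
  have hscale : ∀ t : ℝ, 0 ≤ t → ω (t • x) = t * (∑ i, |x i|) + ρ * (t ^ 2 * ‖x‖ ^ 2) := by
    intro t ht
    rw [hω, norm_smul, Finset.mul_sum, mul_pow, Real.norm_eq_abs, sq_abs]
    simp [abs_mul, abs_of_nonneg ht]
  rcases le_or_gt (ω x) α with h | h
  · have h0 : Metric.infDist x {y | ω y ≤ α} = 0 := Metric.infDist_zero_of_mem h
    rw [h0]
    rw [zero_pow two_ne_zero]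
    exact mul_nonneg (by positivity) (le_max_right _ _)
  · have hS : 0 ≤ ∑ i, |x i| := Finset.sum_nonneg fun i _ => abs_nonneg _
    set S := ∑ i, |x i| with hSdef
    have hx := hω x
    rw [← hSdef] at hx
    have hc : ContinuousOn (fun t : ℝ => t * S + ρ * (t ^ 2 * ‖x‖ ^ 2)) (Set.Icc 0 1) := by
      fun_prop
    have hmem : α ∈ Set.Icc ((fun t : ℝ => t * S + ρ * (t ^ 2 * ‖x‖ ^ 2)) 0)
        ((fun t : ℝ => t * S + ρ * (t ^ 2 * ‖x‖ ^ 2)) 1) := by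
      constructor
      · simpa using hα
      · simp only [one_mul, one_pow]
        linarith
    obtain ⟨t, ⟨ht0, ht1⟩, ht⟩ := intermediate_value_Icc zero_le_one hc hmem
    simp only at ht
    have hle : Metric.infDist x {y | ω y ≤ α} ≤ dist x (t • x) :=
      Metric.infDist_le_dist_of_mem (by
        rw [Set.mem_ofPred_eq, hscale t ht0]
        exact ht.le)
    have hd : dist x (t • x) = (1 - t) * ‖x‖ := by
      have : x - t • x = (1 - t) • x := by rw [sub_smul, one_smul]
      rw [dist_eq_norm, this, norm_smul, Real.norm_eq_abs, abs_of_nonneg (by linarith)]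
    have hsq : Metric.infDist x {y | ω y ≤ α} ^ 2 ≤ ((1 - t) * ‖x‖) ^ 2 := by
      rw [← hd]
      exact pow_le_pow_left₀ Metric.infDist_nonneg hle 2
    refine hsq.trans ?_
    rw [max_eq_left (by linarith), one_div, inv_mul_eq_div, le_div_iff₀ hρ, hx, ← ht]
    have h1 : 0 ≤ (1 - t) * S := mul_nonneg (by linarith) hS
    have h2 : 0 ≤ ρ * ‖x‖ ^ 2 * (t * (1 - t)) :=
      mul_nonneg (by positivity) (mul_nonneg ht0 (by linarith))
    nlinarith [h1, h2]
end

section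
/- Let n ≥ 1 and ρ > 0, and define the elastic-net function ω(x) = ‖x‖₁ + ρ‖x‖₂² on ℝⁿ. Then for every α ≥ 0 and every x ∈ ℝⁿ, dist(x, Lev_ω(α)) ≤ max(ω(x) − α, 0), where dist is the Euclidean distance and Lev_ω(α) = {y : ω(y) ≤ α}. -/
/-- Table 2, elastic-net entry, κ = 1: the elastic-net function
`ω(x) = ‖x‖₁ + ρ‖x‖₂²` has a 1-power global error bound with constant `1`:
`dist(x, Lev_ω(α)) ≤ [ω(x) − α]₊` for every `α ≥ 0` (Euclidean distance). -/
theorem elastic_net_error_bound_one (n : ℕ) (hn : 1 ≤ n) (ρ : ℝ) (hρ : 0 < ρ)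
    (ω : EuclideanSpace ℝ (Fin n) → ℝ)
    (hω : ∀ x, ω x = (∑ i, |x i|) + ρ * ‖x‖ ^ 2) :
    ∀ α : ℝ, 0 ≤ α → ∀ x : EuclideanSpace ℝ (Fin n),
      Metric.infDist x {y | ω y ≤ α} ≤ max (ω x - α) 0 := by
  intro α hα x
  have hS : 0 ≤ ∑ i, |x i| := Finset.sum_nonneg fun i _ => abs_nonneg _
  have hle : ‖x‖ ≤ ∑ i, |x i| := by
    refine abs_le_of_sq_le_sq' ?_ hS |>.2
    rw [EuclideanSpace.norm_sq_eq]
    have h := Finset.sum_sq_le_sq_sum_of_nonneg (s := Finset.univ) (f := fun i => |x i|)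
      (fun i _ => abs_nonneg _)
    simpa using h
  rcases le_or_gt (ω x) α with h | h
  · rw [Metric.infDist_zero_of_mem (show x ∈ {y | ω y ≤ α} from h)]
    exact le_max_right _ _
  · have hpos : 0 < ω x := lt_of_le_of_lt hα h
    obtain ⟨t, ht⟩ : ∃ t, t = α / ω x := ⟨_, rfl⟩
    have ht0 : 0 ≤ t := by rw [ht]; positivity
    have ht1 : t ≤ 1 := by rw [ht]; exact (div_le_one hpos).2 h.le
    have htα : t * ω x = α := by rw [ht]; field_simp
    have hq : 0 ≤ ρ * ‖x‖ ^ 2 := by positivity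
    have hmem : t • x ∈ {y | ω y ≤ α} := by
      have h1 : ω (t • x) = t * (∑ i, |x i|) + t ^ 2 * (ρ * ‖x‖ ^ 2) := by
        rw [hω, norm_smul, Real.norm_of_nonneg ht0, Finset.mul_sum]
        simp only [PiLp.smul_apply, smul_eq_mul, abs_mul, abs_of_nonneg ht0]
        ring
      have h2 : t ^ 2 * (ρ * ‖x‖ ^ 2) ≤ t * (ρ * ‖x‖ ^ 2) :=
        mul_le_mul_of_nonneg_right (by nlinarith) hq
      have h3 := hω x
      show ω (t • x) ≤ α
      rw [h1, ← htα, h3]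
      linarith
    refine (Metric.infDist_le_dist_of_mem hmem).trans (le_max_of_le_left ?_)
    have hd : dist x (t • x) = (1 - t) * ‖x‖ := by
      rw [dist_eq_norm, show x - t • x = (1 - t) • x by rw [sub_smul, one_smul], norm_smul,
        Real.norm_of_nonneg (by linarith)]
    have hx : ‖x‖ ≤ ω x := by rw [hω]; linarith
    rw [hd]
    have := mul_le_mul_of_nonneg_left hx (sub_nonneg.2 ht1)
    linarith
end
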